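/- arXiv:1810.07358 — 5 statements merged into one kernel-verified Lean document; each statement's English description precedes it below -/
import Mathlib

section
/- The set A = {1, 2, 3, 6, 8, 9, 10, 11, 12, 13, 14, 15, 16, 17, 20, 22, 23, 24, 25, 26, 27, 28, 29, 32, 33, 35, 36, 37, 39, 41, 42, 43, 44, 45, 46, 47, 48, 49, 50, 51, 53, 54, 55, 56, 57, 58, 59, 60, 61, 62, 64, 65, 66, 67, 69, 70, 71, 72, 73, 74, 76, 77, 78, 79, 80, 81, 82, 84, 85, 86, 87, 88, 89, 90, 92, 93, 94, 95, 96, 98, 100, 101, 102, 103, 104, 105, 106, 107, 108, 110, 111, 112, 116, 117, 119}, which has cardinality 95, is an MSTD set, i.e. |A+A| > |A-A|. -/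
open Pointwise

theorem aux8 (A : Finset ℤ) (hc : A.card = 95) (hb : ∀ x ∈ A, 1 ≤ x ∧ x ≤ 119)
    (hd : ∀ x ∈ A, x + 112 ∉ A)
    (hs : ∀ s ∈ (Finset.Icc (2 : ℤ) 238).erase 237, ∃ a ∈ A, s - a ∈ A) :
    A.card = 95 ∧ (A + A).card > (A - A).card := by
  refine ⟨hc, ?_⟩
  have h1 : (Finset.Icc (2 : ℤ) 238).erase 237 ⊆ A + A := by
    intro s h
    obtain ⟨a, ha, hsa⟩ := hs s h
    exact Finset.mem_add.2 ⟨a, ha, s - a, hsa, by ring⟩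
  have h2 : A - A ⊆ ((Finset.Icc (-118 : ℤ) 118).erase 112).erase (-112) := by
    intro d h
    obtain ⟨x, hx, y, hy, rfl⟩ := Finset.mem_sub.1 h
    have bx := hb x hx
    have hy' := hb y hy
    simp only [Finset.mem_erase, Finset.mem_Icc]
    refine ⟨fun e => hd x hx ?_, fun e => hd y hy ?_, by omega, by omega⟩
    · have : x + 112 = y := by omega
      rwa [this]
    · have : y + 112 = x := by omega
      rwa [this]
  have c1 := Finset.card_le_card h1
  have c2 := Finset.card_le_card h2
  have e1 : ((Finset.Icc (2 : ℤ) 238).erase 237).card = 236 := by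
    rw [Finset.card_erase_of_mem (by simp)]; simp
  have e2 : (((Finset.Icc (-118 : ℤ) 118).erase 112).erase (-112)).card = 235 := by
    rw [Finset.card_erase_of_mem (by simp), Finset.card_erase_of_mem (by simp)]; simp
  omega

def setA : Finset ℤ := {1, 2, 3, 6, 8, 9, 10, 11, 12, 13, 14, 15, 16, 17, 20, 22, 23, 24, 25, 26, 27, 28, 29, 32, 33, 35, 36, 37, 39, 41, 42, 43, 44, 45, 46, 47, 48, 49, 50, 51, 53, 54, 55, 56, 57, 58, 59, 60, 61, 62, 64, 65, 66, 67, 69, 70, 71, 72, 73, 74, 76, 77, 78, 79, 80, 81, 82, 84, 85, 86, 87, 88, 89, 90, 92, 93, 94, 95, 96, 98, 100, 101, 102, 103, 104, 105, 106, 107, 108, 110, 111, 112, 116, 117, 119}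

theorem setA_card : setA.card = 95 := by decide +kernel

theorem setA_bd : ∀ x ∈ setA, 1 ≤ x ∧ x ≤ 119 := by decide +kernel

theorem setA_diff : ∀ x ∈ setA, x + 112 ∉ setA := by decide +kernel

def maskA : ℕ := 923579008944667753346163348134428494

theorem maskA_bits : ((List.range 239).all fun n =>
    !(Nat.testBit maskA n) || decide ((n : ℤ) ∈ setA)) = true := by decide +kernel

theorem maskA_sum : ((List.range 239).all fun s => Nat.blt s 2 || Nat.beq s 237 ||
    (List.range (s + 1)).any fun a => Nat.testBit maskA a && Nat.testBit maskA (s - a)) = true := by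
  decide +kernel

theorem mem_of_bit (n : ℕ) (hn : n < 239) (h : Nat.testBit maskA n = true) : (n : ℤ) ∈ setA := by
  have := List.all_eq_true.1 maskA_bits n (List.mem_range.2 hn)
  rw [h] at this
  simpa using this

theorem setA_sum : ∀ s ∈ (Finset.Icc (2 : ℤ) 238).erase 237, ∃ a ∈ setA, s - a ∈ setA := by
  intro s hs
  simp only [Finset.mem_erase, Finset.mem_Icc] at hs
  obtain ⟨h7, h2, h8⟩ := hs
  lift s to ℕ using by omega
  have h := List.all_eq_true.1 maskA_sum s (List.mem_range.2 (by omega))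
  rw [Bool.or_eq_true, Bool.or_eq_true] at h
  rcases h with (h | h) | h
  · have := Nat.le_of_ble_eq_true h
    omega
  · have := Nat.eq_of_beq_eq_true h
    omega
  · obtain ⟨a, ha, hb⟩ := List.any_eq_true.1 h
    rw [Bool.and_eq_true] at hb
    have ha' := List.mem_range.1 ha
    refine ⟨a, mem_of_bit a (by omega) hb.1, ?_⟩
    have := mem_of_bit (s - a) (by omega) hb.2
    rwa [Nat.cast_sub (by omega)] at this

theorem stmt_8 :
    let A : Finset ℤ := {1, 2, 3, 6, 8, 9, 10, 11, 12, 13, 14, 15, 16, 17, 20, 22, 23, 24, 25, 26, 27, 28, 29, 32, 33, 35, 36, 37, 39, 41, 42, 43, 44, 45, 46, 47, 48, 49, 50, 51, 53, 54, 55, 56, 57, 58, 59, 60, 61, 62, 64, 65, 66, 67, 69, 70, 71, 72, 73, 74, 76, 77, 78, 79, 80, 81, 82, 84, 85, 86, 87, 88, 89, 90, 92, 93, 94, 95, 96, 98, 100, 101, 102, 103, 104, 105, 106, 107, 108, 110, 111, 112, 116, 117, 119}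
    A.card = 95 ∧ (A + A).card > (A - A).card := by
  exact aux8 setA setA_card setA_bd setA_diff setA_sum
end

section
/- The set A = {0, 1, 2, 5, 7, 8, 11, 12, 13, 14, 15, 16, 17, 19, 20, 21, 22, 23, 24, 25, 26, 27, 28, 29, 30, 31, 32, 33, 34, 37, 38, 39, 40, 41, 42, 43, 44, 45, 47, 48, 49, 50, 51, 52, 53, 54, 55, 56, 57, 59, 60, 61, 62, 63, 65, 66, 68, 71, 72, 73, 74, 75, 76, 78, 79, 80, 81, 82, 83, 84, 85, 86, 87, 88, 91, 92, 93, 94, 95, 96, 97, 98, 99, 101, 102, 104, 105, 106, 109, 110, 112, 113, 114, 115, 116, 117, 118, 119, 120, 121, 122, 123, 124, 125, 127, 129, 130, 131, 132, 133, 134, 136, 137, 138, 140, 141, 142, 146, 147, 149}, which has cardinality 120, is an MSTD set, i.e. |A+A| > |A-A|. -/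
open Pointwise

theorem gen_aux (A : Finset ℤ) (h0 : A.card = 120)
    (h : ∀ a ∈ A, ∀ b ∈ A, -149 ≤ a - b ∧ a - b ≤ 149 ∧ a - b ≠ 143 ∧ a - b ≠ -143)
    (h2 : ∀ s ∈ (Finset.Icc (0 : ℤ) 298).erase 297, ∃ a ∈ A, s - a ∈ A) :
    A.card = 120 ∧ (A + A).card > (A - A).card := by
  refine ⟨h0, ?_⟩
  have hd : A - A ⊆ ((Finset.Icc (-149) 149).erase 143).erase (-143) := by
    intro x hx
    obtain ⟨a, ha, b, hb, rfl⟩ := Finset.mem_sub.1 hx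
    obtain ⟨h1, h2, h3, h4⟩ := h a ha b hb
    exact Finset.mem_erase.2 ⟨h4, Finset.mem_erase.2 ⟨h3, Finset.mem_Icc.2 ⟨h1, h2⟩⟩⟩
  have hs : (Finset.Icc (0 : ℤ) 298).erase 297 ⊆ A + A := by
    intro x hx
    obtain ⟨a, ha, hb⟩ := h2 x hx
    exact Finset.mem_add.2 ⟨a, ha, x - a, hb, add_sub_cancel a x⟩
  have c1 := Finset.card_le_card hd
  have c2 := Finset.card_le_card hs
  have e1 : (((Finset.Icc (-149 : ℤ) 149).erase 143).erase (-143)).card = 297 := by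
    decide +kernel
  have e2 : ((Finset.Icc (0 : ℤ) 298).erase 297).card = 298 := by
    decide +kernel
  rw [e1] at c1
  rw [e2] at c2
  exact lt_of_le_of_lt c1 (lt_of_lt_of_le (by norm_num) c2)

def AA : Finset ℤ := {0, 1, 2, 5, 7, 8, 11, 12, 13, 14, 15, 16, 17, 19, 20, 21, 22, 23, 24, 25, 26, 27, 28, 29, 30, 31, 32, 33, 34, 37, 38, 39, 40, 41, 42, 43, 44, 45, 47, 48, 49, 50, 51, 52, 53, 54, 55, 56, 57, 59, 60, 61, 62, 63, 65, 66, 68, 71, 72, 73, 74, 75, 76, 78, 79, 80, 81, 82, 83, 84, 85, 86, 87, 88, 91, 92, 93, 94, 95, 96, 97, 98, 99, 101, 102, 104, 105, 106, 109, 110, 112, 113, 114, 115, 116, 117, 118, 119, 120, 121, 122, 123, 124, 125, 127, 129, 130, 131, 132, 133, 134, 136, 137, 138, 140, 141, 142, 146, 147, 149}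

/-- Bitmask of `AA`. -/
def BB : ℕ := 991642281548139779556543610947816988679600551

theorem t0 : AA.card = 120 := by decide +kernel

theorem t1a : ∀ a ∈ AA, 0 ≤ a ∧ a ≤ 149 := by decide +kernel

theorem t1b : ∀ a ∈ AA, a - 143 ∉ AA := by decide +kernel

theorem t1 (A : Finset ℤ) (t1a : ∀ a ∈ A, 0 ≤ a ∧ a ≤ 149) (t1b : ∀ a ∈ A, a - 143 ∉ A) :
    ∀ a ∈ A, ∀ b ∈ A,
    -149 ≤ a - b ∧ a - b ≤ 149 ∧ a - b ≠ 143 ∧ a - b ≠ -143 := by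
  intro a ha b hb
  have h1 : 0 ≤ a ∧ a ≤ 149 := t1a a ha
  have h2 : 0 ≤ b ∧ b ≤ 149 := t1a b hb
  refine ⟨by omega, by omega, fun h => ?_, fun h => ?_⟩
  · have e : a - 143 = b := by omega
    have k := t1b a ha
    rw [e] at k
    exact absurd hb k
  · have e : b - 143 = a := by omega
    have k := t1b b hb
    rw [e] at k
    exact absurd ha k

theorem t2a : ∀ n < 150, BB.testBit n = true → (n : ℤ) ∈ AA := by decide +kernel

theorem t2b : ((List.range 299).all fun s => s == 297 ||
    (List.range 150).any fun a => Nat.ble a s && (Nat.ble (s - a) 149 &&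
      (BB.testBit a && BB.testBit (s - a)))) = true := by decide +kernel

theorem t2 (A : Finset ℤ) (t2a : ∀ n < 150, BB.testBit n = true → (n : ℤ) ∈ A) :
    ∀ s ∈ (Finset.Icc (0 : ℤ) 298).erase 297, ∃ a ∈ A, s - a ∈ A := by
  intro s hs
  obtain ⟨hne, hs⟩ := Finset.mem_erase.1 hs
  obtain ⟨h0, h1⟩ := Finset.mem_Icc.1 hs
  lift s to ℕ using h0
  have h := List.all_eq_true.1 t2b s (List.mem_range.2 (by omega))
  rw [Bool.or_eq_true] at h
  rcases h with h | h
  · exact absurd (by exact_mod_cast beq_iff_eq.1 h) hne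
  · obtain ⟨a, ha, h⟩ := List.any_eq_true.1 h
    simp only [Bool.and_eq_true, Nat.ble_eq] at h
    obtain ⟨h1, h2, h3, h4⟩ := h
    refine ⟨a, t2a a (List.mem_range.1 ha) h3, ?_⟩
    have := t2a (s - a) (by omega) h4
    rwa [Nat.cast_sub h1] at this

theorem t3 : AA.card = 120 ∧ (AA + AA).card > (AA - AA).card := 
  gen_aux AA t0 (t1 AA t1a t1b) (t2 AA t2a)

theorem stmt_13 :
    let A : Finset ℤ := {0, 1, 2, 5, 7, 8, 11, 12, 13, 14, 15, 16, 17, 19, 20, 21, 22, 23, 24, 25, 26, 27, 28, 29, 30, 31, 32, 33, 34, 37, 38, 39, 40, 41, 42, 43, 44, 45, 47, 48, 49, 50, 51, 52, 53, 54, 55, 56, 57, 59, 60, 61, 62, 63, 65, 66, 68, 71, 72, 73, 74, 75, 76, 78, 79, 80, 81, 82, 83, 84, 85, 86, 87, 88, 91, 92, 93, 94, 95, 96, 97, 98, 99, 101, 102, 104, 105, 106, 109, 110, 112, 113, 114, 115, 116, 117, 118, 119, 120, 121, 122, 123, 124, 125, 127, 129, 130, 131, 132, 133, 134, 136, 137,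 138, 140, 141, 142, 146, 147, 149}
    A.card = 120 ∧ (A + A).card > (A - A).card := by
  exact t3
end

section
/- No subset of {0, 1, ..., 13} (the first 14 nonnegative integers) is an MSTD set; that is, every subset A of {0, ..., 13} satisfies |A+A| ≤ |A-A|. -/
open Pointwise

def popc : Nat → Nat → Nat
  | 0, _ => 0
  | k+1, x => x % 2 + popc k (x / 2)

def tab : Nat := 0x98878776877676658776766576656554877676657665655476656554655454438776766576656554766565546554544376656554655454436554544354434332877676657665655476656554655454437665655465545443655454435443433276656554655454436554544354434332655454435443433254434332433232218776766576656554766565546554544376656554655454436554544354434332766565546554544365545443544343326554544354434332544343324332322176656554655454436554544354434332655454435443433254434332433232216554544354434332544343324332322154434332433232214332322132212110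

def lk (y : Nat) : Nat := Nat.land (Nat.shiftRight tab (Nat.mul 4 y)) 15

def pop27 (x : Nat) : Nat :=
  Nat.add (lk (Nat.land x 511)) (Nat.add (lk (Nat.land (Nat.shiftRight x 9) 511))
    (lk (Nat.land (Nat.shiftRight x 18) 511)))

def chk : Nat → Nat → Nat → Nat → Bool
  | 0, _, S, P => Nat.ble (pop27 S) (Nat.sub (Nat.mul 2 (pop27 P)) 1)
  | n+1, m, S, P =>
    and (chk n m S P)
      (chk n (Nat.lor m (Nat.shiftLeft 1 n)) (Nat.lor S (Nat.shiftLeft (Nat.lor m (Nat.shiftLeft 1 n)) n))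
        (Nat.lor P (Nat.shiftRight (Nat.lor m (Nat.shiftLeft 1 n)) n)))

theorem popc_eq (k x : Nat) : popc k x = ((Finset.range k).filter (fun i => x.testBit i)).card := by
  induction k generalizing x with
  | zero => simp [popc]
  | succ k ih =>
    rw [popc, ih, Finset.card_filter, Finset.card_filter, Finset.sum_range_succ', add_comm]
    congr 1
    · simp [Nat.testBit_succ]
    · rw [Nat.testBit_zero]
      have := Nat.mod_two_eq_zero_or_one x
      rcases this with h | h <;> simp [h]

theorem popc_add (a b x : Nat) : popc (a + b) x = popc a x + popc b (x / 2 ^ a) := by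
  induction a generalizing x with
  | zero => simp [popc]
  | succ a ih =>
    rw [Nat.succ_add, popc, popc, ih, Nat.div_div_eq_div_mul, pow_succ', add_assoc]

theorem popc_mod (a x : Nat) : popc a (x % 2 ^ a) = popc a x := by
  rw [popc_eq, popc_eq]
  congr 1
  apply Finset.filter_congr
  intro i hi
  rw [Nat.testBit_mod_two_pow]
  simp [Finset.mem_range.1 hi]

set_option maxRecDepth 100000 in
theorem lk_eq : ∀ y < 512, lk y = popc 9 y := by decide +kernel

theorem lk_land (x : Nat) : lk (Nat.land x 511) = popc 9 x := by
  have h : Nat.land x 511 = x % 2 ^ 9 := Nat.and_two_pow_sub_one_eq_mod x 9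
  rw [h, lk_eq (x % 2 ^ 9) (Nat.mod_lt x (by norm_num)), popc_mod]

theorem pop27_eq (x : Nat) : pop27 x = popc 27 x := by
  have h1 : Nat.shiftRight x 9 = x / 2 ^ 9 := Nat.shiftRight_eq_div_pow x 9
  have h2 : Nat.shiftRight x 18 = x / 2 ^ 18 := Nat.shiftRight_eq_div_pow x 18
  have h3 := popc_add 9 18 x
  have h4 := popc_add 9 9 (x / 2 ^ 9)
  rw [Nat.div_div_eq_div_mul, ← pow_add] at h4
  unfold pop27
  rw [lk_land, lk_land, lk_land, h1, h2]
  exact (h3.trans (congrArg _ h4)).symm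

set_option maxRecDepth 100000 in
theorem chk_all : chk 14 0 0 0 = true := by decide +kernel

theorem main_step (A : Finset ℤ) (hA : A ⊆ Finset.Icc 0 13) (n m S P : Nat)
    (hc : chk n m S P = true)
    (hm : ∀ i : ℕ, m.testBit i = true ↔ ((i : ℤ) ∈ A ∧ n ≤ i))
    (hS : ∀ a ∈ A, ∀ b ∈ A, (n : ℤ) ≤ a → (n : ℤ) ≤ b → S.testBit (a + b).toNat = true)
    (hP : ∀ k : ℕ, P.testBit k = true → (k : ℤ) ∈ A - A) :
    (A + A).card ≤ (A - A).card := by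
  induction n generalizing m S P with
  | zero =>
    have hb : ∀ a ∈ A, 0 ≤ a ∧ a ≤ 13 := fun a ha => Finset.mem_Icc.1 (hA ha)
    have hc' : popc 27 S ≤ 2 * popc 27 P - 1 := by
      rw [← pop27_eq, ← pop27_eq]
      exact Nat.le_of_ble_eq_true hc
    rw [popc_eq, popc_eq] at hc'
    set FS := (Finset.range 27).filter (fun i => S.testBit i) with hFS
    set FP := (Finset.range 27).filter (fun i => P.testBit i) with hFP
    have h1 : (A + A).card ≤ FS.card := by
      have : A + A ⊆ FS.image (fun i : ℕ => (i : ℤ)) := by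
        intro x hx
        obtain ⟨a, ha, b, hb', rfl⟩ := Finset.mem_add.1 hx
        have h1 := hb a ha
        have h2 := hb b hb'
        refine Finset.mem_image.2 ⟨(a + b).toNat, ?_, by omega⟩
        rw [hFS, Finset.mem_filter, Finset.mem_range]
        exact ⟨by omega, hS a ha b hb' (by simpa using h1.1) (by simpa using h2.1)⟩
      exact (Finset.card_le_card this).trans Finset.card_image_le
    have h2 : 2 * FP.card ≤ (A - A).card + 1 := by
      have hi := Finset.card_union_add_card_inter
        (FP.image (fun i : ℕ => (i : ℤ))) (FP.image (fun i : ℕ => -(i : ℤ)))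
      rw [Finset.card_image_of_injective _ (fun a b h => by simpa using h),
        Finset.card_image_of_injective _ (fun a b h => by simpa using h)] at hi
      have h3 : (FP.image (fun i : ℕ => (i : ℤ))) ∪ (FP.image (fun i : ℕ => -(i : ℤ))) ⊆ A - A := by
        intro x hx
        rcases Finset.mem_union.1 hx with hx | hx
        · obtain ⟨i, hi, rfl⟩ := Finset.mem_image.1 hx
          exact hP i (Finset.mem_filter.1 hi).2
        · obtain ⟨i, hi, rfl⟩ := Finset.mem_image.1 hx
          obtain ⟨a, ha, b, hb', h⟩ := Finset.mem_sub.1 (hP i (Finset.mem_filter.1 hi).2)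
          exact Finset.mem_sub.2 ⟨b, hb', a, ha, by omega⟩
      have h4 : (FP.image (fun i : ℕ => (i : ℤ))) ∩ (FP.image (fun i : ℕ => -(i : ℤ))) ⊆ {0} := by
        intro x hx
        obtain ⟨hx1, hx2⟩ := Finset.mem_inter.1 hx
        obtain ⟨i, _, hi⟩ := Finset.mem_image.1 hx1
        obtain ⟨j, _, hj⟩ := Finset.mem_image.1 hx2
        rw [Finset.mem_singleton]
        omega
      have h5 := Finset.card_le_card h3
      have h6 := Finset.card_le_card h4
      rw [Finset.card_singleton] at h6
      omega
    omega
  | succ n ih =>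
    have hc : (chk n m S P && chk n (m ||| (1 <<< n)) (S ||| ((m ||| (1 <<< n)) <<< n))
        (P ||| ((m ||| (1 <<< n)) >>> n))) = true := hc
    rw [Bool.and_eq_true] at hc
    by_cases hn : (n : ℤ) ∈ A
    · have hm' : ∀ i : ℕ, (m ||| (1 <<< n)).testBit i = true ↔ ((i : ℤ) ∈ A ∧ n ≤ i) := by
        intro i
        rw [Nat.testBit_or, Bool.or_eq_true, hm, Nat.one_shiftLeft, Nat.testBit_two_pow,
          decide_eq_true_iff]
        constructor
        · rintro (h | rfl)
          · exact ⟨h.1, by omega⟩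
          · exact ⟨hn, le_rfl⟩
        · rintro ⟨h1, h2⟩
          rcases Nat.eq_or_lt_of_le h2 with h | h
          · exact Or.inr h
          · exact Or.inl ⟨h1, h⟩
      have key : ∀ b ∈ A, (n : ℤ) ≤ b →
          ((m ||| (1 <<< n)) <<< n).testBit ((n : ℤ) + b).toNat = true := by
        intro b hb hnb
        rw [Nat.testBit_shiftLeft, Bool.and_eq_true, decide_eq_true_iff, hm']
        have : ((((n : ℤ) + b).toNat - n : ℕ) : ℤ) = b := by omega
        rw [this]
        exact ⟨by omega, hb, by omega⟩
      refine ih _ _ _ hc.2 hm' ?_ ?_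
      · intro a ha b hb h1 h2
        rw [Nat.testBit_or, Bool.or_eq_true]
        rcases eq_or_lt_of_le h1 with h | h
        · right; rw [← h]; exact key b hb h2
        · rcases eq_or_lt_of_le h2 with h' | h'
          · right; rw [← h', add_comm]; exact key a ha h1
          · left; exact hS a ha b hb (by push_cast; omega) (by push_cast; omega)
      · intro k hk
        rw [Nat.testBit_or, Bool.or_eq_true] at hk
        rcases hk with hk | hk
        · exact hP k hk
        · rw [Nat.testBit_shiftRight, hm'] at hk
          exact Finset.mem_sub.2 ⟨_, hk.1, _, hn, by push_cast; ring⟩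
    · refine ih _ _ _ hc.1 ?_ ?_ hP
      · intro i
        rw [hm]
        constructor
        · rintro ⟨h1, h2⟩
          exact ⟨h1, by omega⟩
        · rintro ⟨h1, h2⟩
          refine ⟨h1, ?_⟩
          rcases Nat.eq_or_lt_of_le h2 with h | h
          · subst h; exact absurd h1 hn
          · exact h
      · intro a ha b hb h1 h2
        have h3 : (n : ℤ) ≠ a := fun h => hn (h ▸ ha)
        have h4 : (n : ℤ) ≠ b := fun h => hn (h ▸ hb)
        exact hS a ha b hb (by push_cast; omega) (by push_cast; omega)

theorem stmt_14 :
    ∀ A : Finset ℤ, A ⊆ Finset.Icc 0 13 → (A + A).card ≤ (A - A).card := by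
  intro A hA
  refine main_step A hA 14 0 0 0 chk_all ?_ ?_ ?_
  · intro i
    simp only [Nat.zero_testBit, Bool.false_eq_true, false_iff]
    rintro ⟨h1, h2⟩
    have := (Finset.mem_Icc.1 (hA h1)).2
    omega
  · intro a ha b _ h1 _
    have := (Finset.mem_Icc.1 (hA ha)).2
    push_cast at h1
    omega
  · intro k hk
    simp at hk
end

section
/- The maximal cardinality of an MSTD subset of {0, 1, ..., 14} is 9; that is, there exists an MSTD subset of {0, ..., 14} of cardinality 9, and every MSTD subset of {0, ..., 14} has cardinality at most 9. -/
open Pointwise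

def pc : ℕ → ℕ → ℕ
  | 0, _ => 0
  | k + 1, n => pc k n + n / 2 ^ k % 2

def sm : ℕ → ℕ → ℕ
  | 0, _ => 0
  | k + 1, n => sm k n ||| (n <<< k) * (n / 2 ^ k % 2)

def df : ℕ → ℕ → ℕ
  | 0, _ => 0
  | k + 1, n => df k n ||| (n <<< (14 - k)) * (n / 2 ^ k % 2)

def allB (p : ℕ → Bool) : ℕ → ℕ → ℕ → Bool
  | 0, _, a => p a
  | k + 1, 0, a => allB p k 0 (a + 2 ^ k)
  | k + 1, z + 1, a => allB p k z a && allB p k (z + 1) (a + 2 ^ k)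

def good (n : ℕ) : Bool := Nat.ble (pc 29 (sm 15 n)) (pc 29 (df 15 n))

lemma bit_eq (n k : ℕ) : n / 2 ^ k % 2 = if n.testBit k then 1 else 0 := by
  have := Nat.testBit_eq_decide_div_mod_eq (x := n) (i := k)
  rw [this]
  have h := Nat.mod_two_eq_zero_or_one (n / 2 ^ k)
  rcases h with h | h <;> simp [h]

lemma pc_eq (k n : ℕ) : pc k n = ((Finset.range k).filter (fun i => n.testBit i = true)).card := by
  induction k with
  | zero => simp [pc]
  | succ k ih =>
    rw [pc, ih, bit_eq, Finset.range_add_one, Finset.filter_insert]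
    split_ifs <;> simp

lemma sm_bit (k n j : ℕ) : (sm k n).testBit j = true ↔
    ∃ i < k, n.testBit i = true ∧ i ≤ j ∧ n.testBit (j - i) = true := by
  induction k with
  | zero => simp [sm]
  | succ k ih =>
    rw [sm, Nat.testBit_or, Bool.or_eq_true, ih, bit_eq]
    simp only [Nat.lt_succ_iff_lt_or_eq, or_and_right, exists_or, exists_eq_left]
    apply or_congr Iff.rfl
    split_ifs with h <;> simp [h]

lemma df_bit (k n j : ℕ) : (df k n).testBit j = true ↔
    ∃ i < k, n.testBit i = true ∧ 14 - i ≤ j ∧ n.testBit (j - (14 - i)) = true := by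
  induction k with
  | zero => simp [df]
  | succ k ih =>
    rw [df, Nat.testBit_or, Bool.or_eq_true, ih, bit_eq]
    simp only [Nat.lt_succ_iff_lt_or_eq, or_and_right, exists_or, exists_eq_left]
    apply or_congr Iff.rfl
    split_ifs with h <;> simp [h]

lemma allB_sound (p : ℕ → Bool) (k : ℕ) : ∀ z a, allB p k z a = true →
    ∀ m < 2 ^ k, k ≤ pc k m + z → p (a + m) = true := by
  induction k with
  | zero =>
    intro z a h m hm _
    have : m = 0 := by simpa using hm
    subst this; simpa [allB] using h
  | succ k ih =>
    intro z a h m hm hz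
    have h2 : allB p k z (a + 2 ^ k) = true := by
      cases z with
      | zero => rwa [allB] at h
      | succ z => rw [allB, Bool.and_eq_true] at h; exact h.2
    rw [pc] at hz
    have hle : pc k m ≤ k := by
      rw [pc_eq]; exact (Finset.card_filter_le _ _).trans (by simp)
    by_cases hmk : m < 2 ^ k
    · rw [Nat.div_eq_of_lt hmk] at hz
      cases z with
      | zero => simp at hz; omega
      | succ z =>
        rw [allB, Bool.and_eq_true] at h
        exact ih z a h.1 m hmk (by simp at hz; omega)
    · obtain ⟨m', rfl⟩ : ∃ m', m = 2 ^ k + m' := ⟨m - 2 ^ k, by omega⟩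
      have hm' : m' < 2 ^ k := by rw [pow_succ] at hm; omega
      have e : pc k (2 ^ k + m') = pc k m' := by
        rw [pc_eq, pc_eq]
        congr 1
        apply Finset.filter_congr
        intro i hi
        rw [Nat.testBit_two_pow_add_gt (Finset.mem_range.1 hi)]
      have := ih z (a + 2 ^ k) h2 m' hm' (by rw [e] at hz; omega)
      rwa [add_assoc] at this

set_option maxRecDepth 100000 in
lemma allB_good : allB good 15 5 0 = true := by decide +kernel

theorem stmt_15 :
    (∃ A : Finset ℤ, A ⊆ Finset.Icc 0 14 ∧ (A + A).card > (A - A).card ∧ A.card = 9) ∧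
      (∀ A : Finset ℤ, A ⊆ Finset.Icc 0 14 → (A + A).card > (A - A).card → A.card ≤ 9) := by
  constructor
  · exact ⟨{0, 1, 2, 4, 5, 9, 12, 13, 14}, by decide +kernel, by decide +kernel, by decide +kernel⟩
  · intro A hA hlt
    by_contra! hc
    set n : ℕ := Nat.ofBits (fun i : Fin 15 => decide (((i : ℕ) : ℤ) ∈ A)) with hn
    have hn15 : n < 2 ^ 15 := Nat.ofBits_lt_two_pow _
    have hb : ∀ i : ℕ, n.testBit i = true ↔ (i : ℤ) ∈ A := by
      intro i
      by_cases hi : i < 15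
      · rw [hn, Nat.testBit_ofBits_lt _ _ hi]; simp
      · rw [hn, Nat.testBit_ofBits_ge _ _ (by omega)]
        simp only [Bool.false_eq_true, false_iff]
        intro h
        have := Finset.mem_Icc.1 (hA h)
        omega
    have hcard : A.card ≤ pc 15 n := by
      rw [pc_eq]
      apply Finset.card_le_card_of_injOn Int.toNat
      · intro x hx
        have h := Finset.mem_Icc.1 (hA hx)
        simp only [Finset.coe_filter, Finset.mem_range, Set.mem_ofPred_eq, hb]
        refine ⟨by omega, ?_⟩
        rwa [Int.toNat_of_nonneg h.1]
      · intro x hx y hy hxy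
        have h := Finset.mem_Icc.1 (hA hx)
        have h' := Finset.mem_Icc.1 (hA hy)
        omega
    have hg := allB_sound good 15 5 0 allB_good n hn15 (by omega)
    rw [zero_add, good, Nat.ble_eq] at hg
    have h1 : (A + A).card ≤ pc 29 (sm 15 n) := by
      rw [pc_eq]
      have key : ∀ x ∈ A + A, 0 ≤ x ∧ x ≤ 28 ∧ (sm 15 n).testBit x.toNat = true := by
        intro x hx
        obtain ⟨a, ha, b, hb', rfl⟩ := Finset.mem_add.1 hx
        have h := Finset.mem_Icc.1 (hA ha)
        have h' := Finset.mem_Icc.1 (hA hb')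
        refine ⟨by omega, by omega, ?_⟩
        rw [sm_bit]
        refine ⟨a.toNat, by omega, ?_, by omega, ?_⟩
        · rw [hb, Int.toNat_of_nonneg h.1]; exact ha
        · rw [hb]
          have : (((a + b).toNat - a.toNat : ℕ) : ℤ) = b := by omega
          rw [this]; exact hb'
      apply Finset.card_le_card_of_injOn Int.toNat
      · intro x hx
        have h := key x hx
        simp only [Finset.coe_filter, Finset.mem_range, Set.mem_ofPred_eq]
        exact ⟨by omega, h.2.2⟩
      · intro x hx y hy hxy
        have h := key x hx
        have h' := key y hy
        omega
    have h2 : pc 29 (df 15 n) ≤ (A - A).card := by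
      rw [pc_eq]
      apply Finset.card_le_card_of_injOn (fun j : ℕ => (j : ℤ) - 14)
      · intro j hj
        simp only [Finset.coe_filter, Finset.mem_range, Set.mem_ofPred_eq, df_bit] at hj
        obtain ⟨_, i, hi, h1, h2, h3⟩ := hj
        rw [hb] at h1 h3
        refine Finset.mem_coe.2 (Finset.mem_sub.2 ⟨_, h3, _, h1, ?_⟩)
        simp only
        omega
      · intro x _ y _ hxy
        simp only at hxy
        omega
    omega
end

section
/- The maximal cardinality of an MSTD subset of {0, 1, ..., 15} is 9; that is, there exists an MSTD subset of {0, ..., 15} of cardinality 9, and every MSTD subset of {0, ..., 15} has cardinality at most 9. -/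
open Pointwise

namespace MSTD

/-- number of one bits among the `f` lowest bits -/
def pc : ℕ → ℕ → ℕ
  | 0, _ => 0
  | f + 1, n => n % 2 + pc f (n / 2)

/-- union of the shifts `m <<< i` over the bits `i < k` of `m` -/
def sm (m : ℕ) : ℕ → ℕ
  | 0 => 0
  | k + 1 => Nat.lor (sm m k) (Nat.mul (Nat.mod (Nat.shiftRight m k) 2) (Nat.shiftLeft m k))

/-- union of the shifts `m <<< (15 - i)` over the bits `i < k` of `m` -/
def df (m : ℕ) : ℕ → ℕ
  | 0 => 0
  | k + 1 => Nat.lor (df m k) (Nat.mul (Nat.mod (Nat.shiftRight m k) 2) (Nat.shiftLeft m (Nat.sub 15 k)))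

theorem pc_succ (f n : ℕ) : pc (f + 1) n = n % 2 + pc f (n / 2) := rfl

theorem mod_testBit (m k x : ℕ) :
    Nat.mul (Nat.mod (Nat.shiftRight m k) 2) x = bif m.testBit k then x else 0 := by
  have : Nat.mod (Nat.shiftRight m k) 2 = (m.testBit k).toNat := by
    rw [Nat.testBit_eq_decide_div_mod_eq, ← Nat.shiftRight_eq_div_pow]
    change (m >>> k) % 2 = _
    rcases Nat.mod_two_eq_zero_or_one (m >>> k) with h | h <;> simp [h]
  rw [this]
  cases m.testBit k
  · exact Nat.zero_mul x
  · exact Nat.one_mul x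

theorem sm_succ (m k : ℕ) :
    sm m (k + 1) = bif m.testBit k then sm m k ||| (m <<< k) else sm m k := by
  rw [sm, mod_testBit]
  cases m.testBit k
  · exact Nat.or_zero _
  · rfl

theorem df_succ (m k : ℕ) :
    df m (k + 1) = bif m.testBit k then df m k ||| (m <<< (15 - k)) else df m k := by
  rw [df, mod_testBit]
  cases m.testBit k
  · exact Nat.or_zero _
  · rfl

/-- unrolled version of `sm m 16` -/
def sm16 (m : ℕ) : ℕ :=
  Nat.lor (Nat.lor (Nat.lor (Nat.lor (Nat.lor (Nat.lor (Nat.lor (Nat.lor (Nat.lor (Nat.lor (Nat.lor (Nat.lor (Nat.lor (Nat.lor (Nat.lor (Nat.lor 0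
  (Nat.mul (Nat.mod (Nat.shiftRight m 0) 2) (Nat.shiftLeft m 0)))
  (Nat.mul (Nat.mod (Nat.shiftRight m 1) 2) (Nat.shiftLeft m 1)))
  (Nat.mul (Nat.mod (Nat.shiftRight m 2) 2) (Nat.shiftLeft m 2)))
  (Nat.mul (Nat.mod (Nat.shiftRight m 3) 2) (Nat.shiftLeft m 3)))
  (Nat.mul (Nat.mod (Nat.shiftRight m 4) 2) (Nat.shiftLeft m 4)))
  (Nat.mul (Nat.mod (Nat.shiftRight m 5) 2) (Nat.shiftLeft m 5)))
  (Nat.mul (Nat.mod (Nat.shiftRight m 6) 2) (Nat.shiftLeft m 6)))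
  (Nat.mul (Nat.mod (Nat.shiftRight m 7) 2) (Nat.shiftLeft m 7)))
  (Nat.mul (Nat.mod (Nat.shiftRight m 8) 2) (Nat.shiftLeft m 8)))
  (Nat.mul (Nat.mod (Nat.shiftRight m 9) 2) (Nat.shiftLeft m 9)))
  (Nat.mul (Nat.mod (Nat.shiftRight m 10) 2) (Nat.shiftLeft m 10)))
  (Nat.mul (Nat.mod (Nat.shiftRight m 11) 2) (Nat.shiftLeft m 11)))
  (Nat.mul (Nat.mod (Nat.shiftRight m 12) 2) (Nat.shiftLeft m 12)))
  (Nat.mul (Nat.mod (Nat.shiftRight m 13) 2) (Nat.shiftLeft m 13)))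
  (Nat.mul (Nat.mod (Nat.shiftRight m 14) 2) (Nat.shiftLeft m 14)))
  (Nat.mul (Nat.mod (Nat.shiftRight m 15) 2) (Nat.shiftLeft m 15))

/-- unrolled version of `df m 16` -/
def df16 (m : ℕ) : ℕ :=
  Nat.lor (Nat.lor (Nat.lor (Nat.lor (Nat.lor (Nat.lor (Nat.lor (Nat.lor (Nat.lor (Nat.lor (Nat.lor (Nat.lor (Nat.lor (Nat.lor (Nat.lor (Nat.lor 0
  (Nat.mul (Nat.mod (Nat.shiftRight m 0) 2) (Nat.shiftLeft m 15)))
  (Nat.mul (Nat.mod (Nat.shiftRight m 1) 2) (Nat.shiftLeft m 14)))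
  (Nat.mul (Nat.mod (Nat.shiftRight m 2) 2) (Nat.shiftLeft m 13)))
  (Nat.mul (Nat.mod (Nat.shiftRight m 3) 2) (Nat.shiftLeft m 12)))
  (Nat.mul (Nat.mod (Nat.shiftRight m 4) 2) (Nat.shiftLeft m 11)))
  (Nat.mul (Nat.mod (Nat.shiftRight m 5) 2) (Nat.shiftLeft m 10)))
  (Nat.mul (Nat.mod (Nat.shiftRight m 6) 2) (Nat.shiftLeft m 9)))
  (Nat.mul (Nat.mod (Nat.shiftRight m 7) 2) (Nat.shiftLeft m 8)))
  (Nat.mul (Nat.mod (Nat.shiftRight m 8) 2) (Nat.shiftLeft m 7)))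
  (Nat.mul (Nat.mod (Nat.shiftRight m 9) 2) (Nat.shiftLeft m 6)))
  (Nat.mul (Nat.mod (Nat.shiftRight m 10) 2) (Nat.shiftLeft m 5)))
  (Nat.mul (Nat.mod (Nat.shiftRight m 11) 2) (Nat.shiftLeft m 4)))
  (Nat.mul (Nat.mod (Nat.shiftRight m 12) 2) (Nat.shiftLeft m 3)))
  (Nat.mul (Nat.mod (Nat.shiftRight m 13) 2) (Nat.shiftLeft m 2)))
  (Nat.mul (Nat.mod (Nat.shiftRight m 14) 2) (Nat.shiftLeft m 1)))
  (Nat.mul (Nat.mod (Nat.shiftRight m 15) 2) (Nat.shiftLeft m 0))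

/-- bit count of the lowest four bits, by table lookup -/
def nib (n : ℕ) : ℕ :=
  Nat.mod (Nat.shiftRight 0x4332322132212110 (Nat.mul 4 (Nat.mod n 16))) 16

/-- bit count of the lowest 32 bits -/
def pc32 (n : ℕ) : ℕ :=
  Nat.add (Nat.add (Nat.add (Nat.add (Nat.add (Nat.add (Nat.add (Nat.add 0 (nib (Nat.shiftRight n 28))) (nib (Nat.shiftRight n 24))) (nib (Nat.shiftRight n 20))) (nib (Nat.shiftRight n 16))) (nib (Nat.shiftRight n 12))) (nib (Nat.shiftRight n 8))) (nib (Nat.shiftRight n 4))) (nib n)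

theorem nib_eq (n : ℕ) : nib n = pc 4 n := by
  have h1 : nib n = nib (n % 16) := by
    have : Nat.mod n 16 = Nat.mod (n % 16) 16 := (Nat.mod_mod n 16).symm
    unfold nib
    rw [this]
  have h2 : pc 4 n = pc 4 (n % 16) := by
    simp only [pc]
    omega
  have h3 : ∀ r < 16, nib r = pc 4 r := by decide +kernel
  rw [h1, h2, h3 _ (Nat.mod_lt _ (by norm_num))]

theorem pc32_eq (n : ℕ) : pc32 n = pc 32 n := by
  have hs : ∀ a k, Nat.shiftRight a k = a / 2 ^ k := fun a k => Nat.shiftRight_eq_div_pow a k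
  simp only [pc32, nib_eq, hs, Nat.add_eq, Nat.div_div_eq_div_mul, pc]
  norm_num
  ring

def chk (m : ℕ) : Bool :=
  Nat.ble (pc32 (sm16 m)) (pc32 (df16 m))

theorem sm16_eq (m : ℕ) : sm16 m = sm m 16 := rfl

theorem df16_eq (m : ℕ) : df16 m = df m 16 := rfl

/-- search over the completions of `m` by bits at `w`, `2 w`, ...; `c` counts the bits set so far -/
def search : ℕ → ℕ → ℕ → ℕ → Bool
  | 0, c, _, m => Nat.ble c 9 || chk m
  | k + 1, c, w, m => Nat.ble (Nat.add c k) 8 ||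
      (search k c (Nat.mul 2 w) m && search k (Nat.succ c) (Nat.mul 2 w) (Nat.add m w))

theorem pc_le (k : ℕ) : ∀ r, pc k r ≤ k := by
  induction k with
  | zero => intro r; exact le_rfl
  | succ k ih => intro r; have := ih (r / 2); rw [pc_succ]; omega

theorem search_spec (k : ℕ) : ∀ c w m, search k c w m = true →
    ∀ r < 2 ^ k, 10 ≤ c + pc k r → chk (m + w * r) = true := by
  induction k with
  | zero => 
    intro c w m h r hr hc
    simp only [search, Bool.or_eq_true, Nat.ble_eq] at h
    simp only [pc] at hc
    have : r = 0 := by simpa using hr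
    subst this
    rcases h with h | h
    · omega
    · exact h
  | succ k ih =>
    intro c w m h r hr hc
    simp only [search, Bool.and_eq_true, Bool.or_eq_true, Nat.ble_eq, Nat.add_eq, Nat.mul_eq,
      Nat.succ_eq_add_one] at h
    have hle := pc_le (k + 1) r
    rw [pc_succ] at hc
    rcases h with h | h
    · rw [pc_succ] at hle; omega
    have hr2 : r / 2 < 2 ^ k := by rw [pow_succ] at hr; omega
    have hrr := Nat.mod_add_div r 2
    rcases Nat.mod_two_eq_zero_or_one r with h0 | h0
    · have := ih _ _ _ h.1 (r / 2) hr2 (by omega)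
      rwa [show m + w * r = m + 2 * w * (r / 2) by
        conv_lhs => rw [← hrr, h0]
        ring]
    · have := ih _ _ _ h.2 (r / 2) hr2 (by omega)
      rwa [show m + w * r = m + w + 2 * w * (r / 2) by
        conv_lhs => rw [← hrr, h0]
        ring]

theorem search_true : search 16 0 1 0 = true := by decide +kernel

theorem pc_eq (f : ℕ) : ∀ n, pc f n = ((Finset.range f).filter (fun i => n.testBit i = true)).card := by
  induction f with
  | zero => intro n; rfl
  | succ f ih =>
    intro n
    rw [← Nat.count_eq_card_filter_range, Nat.count_succ', pc_succ, ih, ← Nat.count_eq_card_filter_range]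
    simp only [Nat.testBit_succ, Nat.testBit_zero, decide_eq_true_eq]
    split_ifs <;> omega

theorem sm_spec (m k t : ℕ) :
    (sm m k).testBit t = true ↔ ∃ i < k, m.testBit i = true ∧ i ≤ t ∧ m.testBit (t - i) = true := by
  induction k with
  | zero => simp [sm]
  | succ k ih =>
    simp only [Nat.lt_succ_iff_lt_or_eq, or_and_right, exists_or, exists_eq_left, ← ih, sm_succ]
    cases h : m.testBit k <;> simp

theorem df_spec (m k t : ℕ) :
    (df m k).testBit t = true ↔
      ∃ i < k, m.testBit i = true ∧ 15 - i ≤ t ∧ m.testBit (t - (15 - i)) = true := by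
  induction k with
  | zero => simp [df]
  | succ k ih =>
    simp only [Nat.lt_succ_iff_lt_or_eq, or_and_right, exists_or, exists_eq_left, ← ih, df_succ]
    cases h : m.testBit k <;> simp

theorem exists_mask (p : ℕ → Prop) (k : ℕ) :
    ∃ m < 2 ^ k, ∀ i, m.testBit i = true ↔ i < k ∧ p i := by
  classical
  refine ⟨Nat.ofBits (fun i : Fin k => decide (p i)), Nat.ofBits_lt_two_pow _, fun i => ?_⟩
  by_cases h : i < k
  · simp [Nat.testBit_ofBits_lt _ _ h, h]
  · simp [Nat.testBit_ofBits_ge _ _ (not_lt.mp h), h]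

theorem card_shift (B : Finset ℤ) (n c f : ℕ) 
    (h : ∀ t : ℕ, (t < f ∧ n.testBit t = true) ↔ (t : ℤ) - c ∈ B) (hB : ∀ x ∈ B, -(c : ℤ) ≤ x) :
    pc f n = B.card := by
  rw [pc_eq]
  refine Finset.card_bij (fun t _ => (t : ℤ) - c) ?_ ?_ ?_
  · intro t ht
    exact (h t).1 (by simpa using ht)
  · intro a _ b _ hab
    have : (a : ℤ) - c = b - c := hab
    omega
  · intro x hx
    have h1 := hB x hx
    have h2 : (((x + c).toNat : ℕ) : ℤ) - c = x := by omega
    refine ⟨(x + c).toNat, ?_, h2⟩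
    have := (h (x + c).toNat).2 (by rw [h2]; exact hx)
    simpa using this

theorem upper (A : Finset ℤ) (hA : A ⊆ Finset.Icc 0 15) (hc : (A + A).card > (A - A).card) :
    A.card ≤ 9 := by
  obtain ⟨m, hm, hb⟩ := exists_mask (fun i => (i : ℤ) ∈ A) 16
  have hr : ∀ x ∈ A, 0 ≤ x ∧ x ≤ 15 := fun x hx => by simpa using hA hx
  have hb' : ∀ i, m.testBit i = true ↔ (i : ℤ) ∈ A := fun i => by
    rw [hb]
    exact ⟨fun h => h.2, fun h => ⟨by have := hr _ h; omega, h⟩⟩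
  have h1 : pc 16 m = A.card := by
    refine card_shift A m 0 16 (fun t => ?_) (fun x hx => by have := hr x hx; simpa using this.1)
    rw [hb']
    simp only [Nat.cast_zero, sub_zero]
    exact ⟨fun h => h.2, fun h => ⟨by have := hr _ h; omega, h⟩⟩
  have h2 : pc 32 (sm m 16) = (A + A).card := by
    refine card_shift _ _ 0 32 (fun t => ?_) ?_
    · rw [sm_spec]
      simp only [hb', Nat.cast_zero, sub_zero, Finset.mem_add]
      constructor
      · rintro ⟨_, i, _, hi, hit, hj⟩
        exact ⟨_, hi, _, hj, by omega⟩
      · rintro ⟨x, hx, y, hy, hxy⟩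
        have hx' := hr x hx
        have hy' := hr y hy
        refine ⟨by omega, x.toNat, by omega, ?_, by omega, ?_⟩
        · rwa [show ((x.toNat : ℕ) : ℤ) = x by omega]
        · rwa [show ((t - x.toNat : ℕ) : ℤ) = y by omega]
    · intro x hx
      obtain ⟨a, ha, b, hb, rfl⟩ := Finset.mem_add.1 hx
      have := hr a ha
      have := hr b hb
      simp only [Nat.cast_zero]
      omega
  have h3 : pc 32 (df m 16) = (A - A).card := by
    refine card_shift _ _ 15 32 (fun t => ?_) ?_
    · rw [df_spec]
      simp only [hb', Finset.mem_sub]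
      constructor
      · rintro ⟨_, i, _, hi, hit, hj⟩
        exact ⟨_, hj, _, hi, by omega⟩
      · rintro ⟨y, hy, x, hx, hxy⟩
        have hx' := hr x hx
        have hy' := hr y hy
        refine ⟨by omega, x.toNat, by omega, ?_, by omega, ?_⟩
        · rwa [show ((x.toNat : ℕ) : ℤ) = x by omega]
        · rwa [show ((t - (15 - x.toNat) : ℕ) : ℤ) = y by omega]
    · intro x hx
      obtain ⟨a, ha, b, hb, rfl⟩ := Finset.mem_sub.1 hx
      have := hr a ha
      have := hr b hb
      omega
  by_contra hcon
  have := search_spec 16 0 1 0 search_true m hm (by omega)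
  simp only [one_mul, zero_add, chk, Nat.ble_eq, pc32_eq, sm16_eq, df16_eq, h2, h3] at this
  omega

end MSTD

theorem stmt_16 :
    (∃ A : Finset ℤ, A ⊆ Finset.Icc 0 15 ∧ (A + A).card > (A - A).card ∧ A.card = 9) ∧
      (∀ A : Finset ℤ, A ⊆ Finset.Icc 0 15 → (A + A).card > (A - A).card → A.card ≤ 9) := by
  refine ⟨⟨{1, 2, 3, 6, 10, 11, 13, 14, 15}, ?_, ?_, ?_⟩, MSTD.upper⟩
  · decide +kernel
  · decide +kernel
  · decide +kernel
end
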